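/- Let A_{-1}, A_0, A_1, G be as in the context, with G𝟙 = 𝟙. Assume there are real numbers θ > 0, γ < 1 and σ < 1 such that θ𝟙 ≤ A_{-1}𝟙, A_1𝟙 ≤ γ·A_{-1}𝟙 and (A_{-1} − A_1)𝟙 ≥ (1 − σ)𝟙 entrywise, and set τ := min(γ, σ) and L(X) := A_1X² + (A_0 − I)X + A_{-1}. Then W := I − A_0 − A_1G is invertible in B(ℓ∞) with ‖W^{-1}A_1‖ < 1, and, with β := 2‖W^{-1}‖/(1 − ‖W^{-1}A_1‖), there exist sequences X, Z : ℕ → B(ℓ∞) such that X_0 = 0, X_{k+1} = X_k − Z_k, and for every k: (i) (A_1X_k + A_0 − I)Z_k + A_1Z_kX_k = L(X_k) and ‖Z_k‖ ≤ β; (ii) −Z_k is positive and L(X_{k+1}) is positive; (iii) 0 ≤ X_k ≤ X_{k+1} ≤ G; (iv) ‖G − X_{k+1}‖ ≤ (τ/(1 − τ)) · ‖G − X_k‖². -/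

import Mathlib

open BoundedContinuousFunction Filter

noncomputable section

/-- ℓ∞: the Banach space of bounded real sequences with the sup norm. -/
abbrev Linf : Type := BoundedContinuousFunction ℕ ℝ

/-- A sequence is nonnegative if all its entries are nonnegative. -/
def vnonneg (x : Linf) : Prop := ∀ i, 0 ≤ x i

/-- An operator in B(ℓ∞) is positive if it maps nonnegative sequences to
nonnegative sequences. -/
def OpPos (A : Linf →L[ℝ] Linf) : Prop := ∀ x : Linf, vnonneg x → vnonneg (A x)

/-- The constant sequence with all entries equal to one. -/
def ones : Linf := BoundedContinuousFunction.const ℕ (1 : ℝ)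

section NormedRing

variable {𝔄 : Type*} [NormedRing 𝔄]

lemma norm_stein_le {p q y z : 𝔄} (hp1 : ‖p‖ < 1) (hq1 : ‖q‖ ≤ 1)
    (h : z - p * z * q = y) : ‖z‖ ≤ ‖y‖ / (1 - ‖p‖) := by
  have h1 : ‖p * z * q‖ ≤ ‖p‖ * ‖z‖ :=
    (norm_mul_le _ _).trans <|
      (mul_le_of_le_one_right (norm_nonneg _) hq1).trans (norm_mul_le _ _)
  have h2 : ‖z‖ ≤ ‖y‖ + ‖p * z * q‖ := by
    rw [← h]
    simpa using norm_add_le (z - p * z * q) (p * z * q)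
  rw [le_div_iff₀ (by linarith)]
  linarith

variable [CompleteSpace 𝔄] {C : Subsemiring 𝔄}

/-- The Stein equation `z - p z q = y` with data in a closed cone of a Banach algebra has a solution
in the cone when `p` is a strict contraction and `q` is a contraction. -/
lemma exists_mem_stein (hC : IsClosed (C : Set 𝔄)) {p q y : 𝔄} (hp : p ∈ C) (hq : q ∈ C)
    (hy : y ∈ C) (hp1 : ‖p‖ < 1) (hq1 : ‖q‖ ≤ 1) : ∃ z ∈ C, z - p * z * q = y := by
  have hbound (n : ℕ) : ‖p ^ n * y * q ^ n‖ ≤ ‖p‖ ^ n * ‖y‖ := by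
    induction n with
    | zero => simp
    | succ n ih =>
      calc ‖p ^ (n + 1) * y * q ^ (n + 1)‖ = ‖p * (p ^ n * y * q ^ n) * q‖ := by
            rw [pow_succ' p, pow_succ q]; simp only [mul_assoc]
        _ ≤ ‖p * (p ^ n * y * q ^ n)‖ * ‖q‖ := norm_mul_le _ _
        _ ≤ ‖p * (p ^ n * y * q ^ n)‖ := mul_le_of_le_one_right (norm_nonneg _) hq1
        _ ≤ ‖p‖ * (‖p‖ ^ n * ‖y‖) := norm_mul_le_of_le le_rfl ih
        _ = ‖p‖ ^ (n + 1) * ‖y‖ := by ring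
  have hs : Summable fun n => p ^ n * y * q ^ n :=
    .of_norm_bounded ((summable_geometric_of_lt_one (norm_nonneg _) hp1).mul_right _) hbound
  refine ⟨∑' n, p ^ n * y * q ^ n, ?_, ?_⟩
  · exact hC.mem_of_tendsto hs.hasSum (.of_forall fun s =>
      C.sum_mem fun n _ => C.mul_mem (C.mul_mem (C.pow_mem hp n) hy) (C.pow_mem hq n))
  have hshift : p * (∑' n, p ^ n * y * q ^ n) * q = ∑' n, p ^ (n + 1) * y * q ^ (n + 1) := by
    rw [← hs.tsum_mul_left, ← (hs.mul_left p).tsum_mul_right]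
    refine tsum_congr fun n => ?_
    rw [pow_succ' p, pow_succ q]; simp only [mul_assoc]
  rw [hshift, hs.tsum_eq_zero_add]
  simp

lemma mem_of_stein (hC : IsClosed (C : Set 𝔄)) {p q y z : 𝔄} (hp : p ∈ C) (hq : q ∈ C)
    (hy : y ∈ C) (hp1 : ‖p‖ < 1) (hq1 : ‖q‖ ≤ 1) (h : z - p * z * q = y) : z ∈ C := by
  obtain ⟨z', hz', h'⟩ := exists_mem_stein hC hp hq hy hp1 hq1
  have h0 : (z - z') - p * (z - z') * q = 0 := by
    rw [← sub_self y]
    nth_rewrite 1 [← h]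
    rw [← h']
    noncomm_ring
  have := norm_stein_le hp1 hq1 h0
  rw [norm_zero, zero_div] at this
  rwa [sub_eq_zero.1 (norm_le_zero_iff.1 this)]

/-- Neumann series: `1 - t` has an inverse in the cone, dominating `1`, when `t` is a strict
contraction in the cone. -/
lemma exists_mem_inverse (hC : IsClosed (C : Set 𝔄)) (hone : ‖(1 : 𝔄)‖ ≤ 1) {t : 𝔄}
    (ht : t ∈ C) (ht1 : ‖t‖ < 1) :
    ∃ r ∈ C, r - 1 ∈ C ∧ (1 - t) * r = 1 ∧ r * (1 - t) = 1 := by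
  obtain ⟨r, hr, h⟩ := exists_mem_stein hC ht C.one_mem C.one_mem ht1 hone
  rw [mul_one] at h
  have hr1 : (1 - t) * r = 1 := by rw [sub_mul, one_mul, h]
  refine ⟨r, hr, ?_, hr1, ?_⟩
  · rw [← h, sub_sub_cancel]
    exact C.mul_mem ht hr
  · obtain ⟨u, hu⟩ := isUnit_one_sub_of_norm_lt_one ht1
    rw [← hu] at hr1 ⊢
    rw [← Units.inv_eq_of_mul_eq_one_right hr1, Units.inv_mul]

/-- Iterate a step that preserves an invariant. -/
lemma exists_seq_of_step {E : Type*} [AddGroup E] {p : E → Prop} {q : E → E → Prop} {a : E}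
    (ha : p a) (hstep : ∀ x, p x → ∃ z, q x z ∧ p (x - z)) :
    ∃ X Z : ℕ → E, X 0 = a ∧ (∀ k, X (k + 1) = X k - Z k) ∧ ∀ k, p (X k) ∧ q (X k) (Z k) := by
  choose f hf using hstep
  let Y : ℕ → {x // p x} := fun k =>
    Nat.rec ⟨a, ha⟩ (fun _ x => ⟨x.1 - f x.1 x.2, (hf x.1 x.2).2⟩) k
  exact ⟨fun k => (Y k).1, fun k => f (Y k).1 (Y k).2, rfl, fun _ => rfl,
    fun k => ⟨(Y k).2, (hf _ (Y k).2).1⟩⟩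

/-- One step of Newton's iteration for `A₁X² + (A₀ - 1)X + A₋₁`, started between `0` and a solution
`G` at a point with nonnegative residual. Here `Winv` is the inverse of `1 - A₀ - A₁G`. -/
lemma exists_newton_step (hC : IsClosed (C : Set 𝔄))
    (hmono : ∀ a b : 𝔄, a ∈ C → b - a ∈ C → ‖a‖ ≤ ‖b‖) (hone : ‖(1 : 𝔄)‖ ≤ 1)
    {Am1 A0 A1 G Winv X : 𝔄} (hA0 : A0 ∈ C) (hA1 : A1 ∈ C)
    (heq : A1 * G ^ 2 + A0 * G + Am1 = G) (hG1 : ‖G‖ ≤ 1)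
    (hT : ‖A0 + A1 * G‖ < 1) (hWpos : Winv ∈ C) (hW : Winv * (1 - A0 - A1 * G) = 1)
    (hWA : ‖Winv * A1‖ < 1) (hX : X ∈ C) (hXG : G - X ∈ C)
    (hL : A1 * X ^ 2 + (A0 - 1) * X + Am1 ∈ C) :
    ∃ Z, (A1 * X + A0 - 1) * Z + A1 * (Z * X) = A1 * X ^ 2 + (A0 - 1) * X + Am1 ∧
      ‖Z‖ ≤ 2 * ‖Winv‖ / (1 - ‖Winv * A1‖) ∧ -Z ∈ C ∧
      A1 * (X - Z) ^ 2 + (A0 - 1) * (X - Z) + Am1 ∈ C ∧ G - (X - Z) ∈ C ∧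
      ‖G - (X - Z)‖ ≤ ‖Winv * A1‖ / (1 - ‖Winv * A1‖) * ‖G - X‖ ^ 2 := by
  have hXn : ‖X‖ ≤ 1 := (hmono _ _ hX hXG).trans hG1
  have hTX : A0 + A1 * X ∈ C := C.add_mem hA0 (C.mul_mem hA1 hX)
  have hTXn : ‖A0 + A1 * X‖ < 1 := by
    refine (hmono _ _ hTX ?_).trans_lt hT
    rw [add_sub_add_left_eq_sub, ← mul_sub]
    exact C.mul_mem hA1 hXG
  obtain ⟨R, hR, -, hR1, hR2⟩ := exists_mem_inverse hC hone hTX hTXn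
  have hRW : Winv - R ∈ C := by
    have : Winv - R = Winv * (A1 * (G - X)) * R := by
      calc Winv - R = Winv * ((1 - (A0 + A1 * X)) * R) - Winv * (1 - A0 - A1 * G) * R := by
            rw [hR1, hW, mul_one, one_mul]
        _ = _ := by noncomm_ring
    rw [this]
    exact C.mul_mem (C.mul_mem hWpos (C.mul_mem hA1 hXG)) hR
  have hRn : ‖R‖ ≤ ‖Winv‖ := hmono _ _ hR hRW
  have hP : R * A1 ∈ C := C.mul_mem hR hA1
  have hPn : ‖R * A1‖ ≤ ‖Winv * A1‖ := by
    refine hmono _ _ hP ?_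
    rw [← sub_mul]
    exact C.mul_mem hRW hA1
  have hP1 := hPn.trans_lt hWA
  set L := A1 * X ^ 2 + (A0 - 1) * X + Am1 with hLdef
  obtain ⟨V, hV, hVeq⟩ := exists_mem_stein hC hP hX (C.mul_mem hR hL) hP1 hXn
  have hnewton : (1 - (A0 + A1 * X)) * V - A1 * V * X = L := by
    calc (1 - (A0 + A1 * X)) * V - A1 * V * X
        = (1 - (A0 + A1 * X)) * V - ((1 - (A0 + A1 * X)) * R) * (A1 * V * X) := by
          rw [hR1, one_mul]
      _ = (1 - (A0 + A1 * X)) * (V - R * A1 * V * X) := by noncomm_ring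
      _ = ((1 - (A0 + A1 * X)) * R) * L := by rw [hVeq, mul_assoc]
      _ = L := by rw [hR1, one_mul]
  have hLn : ‖L‖ ≤ 2 := by
    refine (hmono L G hL ?_).trans (hG1.trans one_le_two)
    have : G - L = A1 * (X * (G - X) + (G - X) * X + (G - X) ^ 2) + A0 * (G - X) + X := by
      calc G - L = A1 * G ^ 2 + A0 * G + Am1 - L := by rw [heq]
        _ = _ := by rw [hLdef]; noncomm_ring
    rw [this]
    exact C.add_mem (C.add_mem (C.mul_mem hA1 (C.add_mem (C.add_mem (C.mul_mem hX hXG)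
      (C.mul_mem hXG hX)) (C.pow_mem hXG 2))) (C.mul_mem hA0 hXG)) hX
  have hEeq : (G - X - V) - R * A1 * (G - X - V) * X = R * A1 * (G - X) ^ 2 := by
    have h1 : L = (1 - (A0 + A1 * X)) * (G - X) - A1 * (G - X) * X - A1 * (G - X) ^ 2 := by
      calc L = L + (G - (A1 * G ^ 2 + A0 * G + Am1)) := by rw [heq, sub_self, add_zero]
        _ = _ := by rw [hLdef]; noncomm_ring
    calc (G - X - V) - R * A1 * (G - X - V) * X
        = (R * (1 - (A0 + A1 * X))) * (G - X) - R * A1 * (G - X) * X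
            - (V - R * A1 * V * X) := by rw [hR2]; noncomm_ring
      _ = _ := by rw [hVeq, h1]; noncomm_ring
  have hres : A1 * (X + V) ^ 2 + (A0 - 1) * (X + V) + Am1 = A1 * V ^ 2 := by
    calc A1 * (X + V) ^ 2 + (A0 - 1) * (X + V) + Am1
        = L - ((1 - (A0 + A1 * X)) * V - A1 * V * X) + A1 * V ^ 2 := by
          rw [hLdef]; noncomm_ring
      _ = _ := by rw [hnewton]; simp
  have hden : 0 < 1 - ‖Winv * A1‖ := by linarith
  have hden' : 1 - ‖Winv * A1‖ ≤ 1 - ‖R * A1‖ := by linarith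
  refine ⟨-V, ?_, ?_, by rwa [neg_neg], ?_, ?_, ?_⟩
  · rw [← hnewton]
    noncomm_ring
  · rw [norm_neg]
    refine (norm_stein_le hP1 hXn hVeq).trans ?_
    refine div_le_div₀ (by positivity) ?_ hden hden'
    rw [mul_comm]
    exact norm_mul_le_of_le hRn hLn
  · rw [sub_neg_eq_add, hres]
    exact C.mul_mem hA1 (C.pow_mem hV 2)
  · rw [sub_neg_eq_add, ← sub_sub]
    exact mem_of_stein hC hP hX (C.mul_mem hP (C.pow_mem hXG 2)) hP1 hXn hEeq
  · rw [sub_neg_eq_add, ← sub_sub]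
    refine (norm_stein_le hP1 hXn hEeq).trans ?_
    rw [div_mul_eq_mul_div]
    exact div_le_div₀ (by positivity)
      (norm_mul_le_of_le hPn (norm_pow_le' _ two_pos)) hden hden'

/-- Newton's iteration for `A₁X² + (A₀ - 1)X + A₋₁` from `0`: monotone and quadratic convergence
in a Banach algebra with a closed cone on which the norm is monotone. -/
lemma exists_newton_seq (hC : IsClosed (C : Set 𝔄))
    (hmono : ∀ a b : 𝔄, a ∈ C → b - a ∈ C → ‖a‖ ≤ ‖b‖) (hone : ‖(1 : 𝔄)‖ ≤ 1)
    {Am1 A0 A1 G Winv : 𝔄} (hAm1 : Am1 ∈ C) (hA0 : A0 ∈ C) (hA1 : A1 ∈ C) (hG : G ∈ C)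
    (heq : A1 * G ^ 2 + A0 * G + Am1 = G) (hG1 : ‖G‖ ≤ 1)
    (hT : ‖A0 + A1 * G‖ < 1) (hWpos : Winv ∈ C) (hW : Winv * (1 - A0 - A1 * G) = 1)
    {τ : ℝ} (hτ : τ < 1) (hWA : ‖Winv * A1‖ ≤ τ) :
    ∃ X Z : ℕ → 𝔄, X 0 = 0 ∧ (∀ k, X (k + 1) = X k - Z k) ∧ ∀ k,
      (A1 * X k + A0 - 1) * Z k + A1 * (Z k * X k) = A1 * X k ^ 2 + (A0 - 1) * X k + Am1 ∧
      ‖Z k‖ ≤ 2 * ‖Winv‖ / (1 - ‖Winv * A1‖) ∧ -Z k ∈ C ∧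
      A1 * X (k + 1) ^ 2 + (A0 - 1) * X (k + 1) + Am1 ∈ C ∧
      X k ∈ C ∧ X (k + 1) - X k ∈ C ∧ G - X k ∈ C ∧
      ‖G - X (k + 1)‖ ≤ τ / (1 - τ) * ‖G - X k‖ ^ 2 := by
  have hWA1 := hWA.trans_lt hτ
  obtain ⟨X, Z, hX0, hXs, h⟩ := exists_seq_of_step
    (p := fun X => X ∈ C ∧ G - X ∈ C ∧ A1 * X ^ 2 + (A0 - 1) * X + Am1 ∈ C)
    (q := fun X Z => (A1 * X + A0 - 1) * Z + A1 * (Z * X) = A1 * X ^ 2 + (A0 - 1) * X + Am1 ∧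
      ‖Z‖ ≤ 2 * ‖Winv‖ / (1 - ‖Winv * A1‖) ∧ -Z ∈ C ∧
      ‖G - (X - Z)‖ ≤ τ / (1 - τ) * ‖G - X‖ ^ 2)
    (a := 0) ⟨C.zero_mem, by simpa using hG, by simpa using hAm1⟩ (by
      rintro X ⟨hX, hXG, hL⟩
      obtain ⟨Z, h1, h2, h3, h4, h5, h6⟩ :=
        exists_newton_step hC hmono hone hA0 hA1 heq hG1 hT hWpos hW hWA1 hX hXG hL
      refine ⟨Z, ⟨h1, h2, h3, h6.trans ?_⟩, ?_, h5, h4⟩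
      · refine mul_le_mul_of_nonneg_right ?_ (by positivity)
        exact div_le_div₀ ((norm_nonneg _).trans hWA) hWA (by linarith) (by linarith)
      · rw [sub_eq_add_neg]
        exact C.add_mem hX h3)
  refine ⟨X, Z, hX0, hXs, fun k => ?_⟩
  obtain ⟨⟨hp1, hp2, -⟩, hq1, hq2, hq3, hq4⟩ := h k
  refine ⟨hq1, hq2, hq3, (h (k + 1)).1.2.2, hp1, ?_, hp2, ?_⟩
  · rw [hXs]
    simpa using hq3
  · rw [hXs]
    exact hq4

end NormedRing

lemma OpPos.mono {A : Linf →L[ℝ] Linf} (hA : OpPos A) {x y : Linf}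
    (h : ∀ i, x i ≤ y i) (i : ℕ) : A x i ≤ A y i := by
  have := hA (y - x) (fun j => sub_nonneg.2 (h j)) i
  rw [map_sub] at this
  exact sub_nonneg.1 this

lemma vnonneg_ones : vnonneg ones := fun _ => zero_le_one

lemma norm_ones_le : ‖ones‖ ≤ 1 :=
  (BoundedContinuousFunction.norm_le zero_le_one).2 fun i => by simp [ones]

lemma apply_ones_le_norm (A : Linf →L[ℝ] Linf) (i : ℕ) : A ones i ≤ ‖A‖ :=
  calc A ones i ≤ ‖A ones i‖ := le_abs_self _
    _ ≤ ‖A ones‖ := (A ones).norm_coe_le_norm i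
    _ ≤ ‖A‖ * ‖ones‖ := A.le_opNorm _
    _ ≤ ‖A‖ := mul_le_of_le_one_right A.opNorm_nonneg norm_ones_le

/-- The norm of a positive operator is controlled by its value at the constant sequence `1`. -/
lemma OpPos.norm_le {A : Linf →L[ℝ] Linf} (hA : OpPos A) {c : ℝ}
    (h : ∀ i, A ones i ≤ c) : ‖A‖ ≤ c := by
  have hc : 0 ≤ c := (hA _ vnonneg_ones 0).trans (h 0)
  refine A.opNorm_le_bound hc fun x => ?_
  refine (BoundedContinuousFunction.norm_le (by positivity)).2 fun i => ?_
  have hx (j : ℕ) : |x j| ≤ ‖x‖ := x.norm_coe_le_norm j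
  have hs : A (‖x‖ • ones) i ≤ c * ‖x‖ := by
    rw [map_smul, mul_comm]
    exact mul_le_mul_of_nonneg_left (h i) (norm_nonneg x)
  have hup := hA.mono (x := x) (y := ‖x‖ • ones)
    (fun j => by simpa [ones] using (abs_le.1 (hx j)).2) i
  have hlo := hA.mono (x := -x) (y := ‖x‖ • ones)
    (fun j => by simpa [ones] using neg_le.1 (abs_le.1 (hx j)).1) i
  rw [map_neg] at hlo
  rw [Real.norm_eq_abs, abs_le]
  exact ⟨neg_le.1 (hlo.trans hs), hup.trans hs⟩

lemma OpPos.norm_mono {A B : Linf →L[ℝ] Linf} (hA : OpPos A) (hAB : OpPos (B - A)) :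
    ‖A‖ ≤ ‖B‖ :=
  hA.norm_le fun i => (sub_nonneg.1 (hAB _ vnonneg_ones i)).trans (apply_ones_le_norm B i)

/-- The positive operators on `ℓ∞`. -/
def posCone : Subsemiring (Linf →L[ℝ] Linf) where
  carrier := {A | OpPos A}
  mul_mem' hA hB x hx := hA _ (hB x hx)
  one_mem' _ hx := hx
  add_mem' hA hB x hx i := add_nonneg (hA x hx i) (hB x hx i)
  zero_mem' _ _ _ := le_rfl

lemma isClosed_posCone : IsClosed (posCone : Set (Linf →L[ℝ] Linf)) := by
  have : (posCone : Set (Linf →L[ℝ] Linf)) =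
      ⋂ (x : Linf) (_ : vnonneg x) (i : ℕ), {A | 0 ≤ A x i} := by
    ext A
    simp only [Set.mem_iInter]
    rfl
  rw [this]
  refine isClosed_iInter fun x => isClosed_iInter fun _ => isClosed_iInter fun i => ?_
  exact isClosed_le continuous_const ((BoundedContinuousFunction.evalCLM ℝ i).continuous.comp
    (ContinuousLinearMap.apply ℝ Linf x).continuous)

/-- Newton's iteration for L(X) = A₁X² + (A₀ - I)X + A₋₁ starting at X₀ = 0:
W = I - A₀ - A₁G is invertible with ‖W⁻¹A₁‖ < 1, the Newton corrections exist,
are uniformly bounded by β and nonpositive, the residuals L(Xₖ₊₁) stay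
nonnegative, the iterates increase monotonically to G, and the error converges
quadratically. -/
theorem stmt7
    (Am1 A0 A1 G : Linf →L[ℝ] Linf)
    (hAm1 : OpPos Am1) (hA0 : OpPos A0) (hA1 : OpPos A1) (hG : OpPos G)
    (hstoch : (Am1 + A0 + A1) ones = ones)
    (heq : A1 * G ^ 2 + A0 * G + Am1 = G)
    (hG1 : G ones = ones)
    (θ γ σ : ℝ) (hθpos : 0 < θ) (hγ : γ < 1) (hσ : σ < 1)
    (hθ : ∀ i, θ ≤ (Am1 ones) i)
    (hγle : ∀ i, (A1 ones) i ≤ γ * (Am1 ones) i)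
    (hgap : ∀ i, 1 - σ ≤ ((Am1 - A1) ones) i) :
    ∃ Winv : Linf →L[ℝ] Linf,
      (1 - A0 - A1 * G) * Winv = 1 ∧ Winv * (1 - A0 - A1 * G) = 1 ∧
      ‖Winv * A1‖ < 1 ∧
      ∃ X Z : ℕ → Linf →L[ℝ] Linf,
        X 0 = 0 ∧ (∀ k, X (k + 1) = X k - Z k) ∧
        ∀ k,
          ((A1 * X k + A0 - 1) * Z k + A1 * (Z k * X k)
              = A1 * (X k) ^ 2 + (A0 - 1) * X k + Am1) ∧
          ‖Z k‖ ≤ 2 * ‖Winv‖ / (1 - ‖Winv * A1‖) ∧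
          OpPos (-(Z k)) ∧
          OpPos (A1 * (X (k + 1)) ^ 2 + (A0 - 1) * X (k + 1) + Am1) ∧
          OpPos (X k) ∧ OpPos (X (k + 1) - X k) ∧ OpPos (G - X k) ∧
          ‖G - X (k + 1)‖ ≤ min γ σ / (1 - min γ σ) * ‖G - X k‖ ^ 2 := by
  have hsum (i : ℕ) : Am1 ones i + A0 ones i + A1 ones i = 1 := DFunLike.congr_fun hstoch i
  have hT : OpPos (A0 + A1 * G) := posCone.add_mem hA0 (posCone.mul_mem hA1 hG)
  have hTones (i : ℕ) : (A0 + A1 * G) ones i = A0 ones i + A1 ones i :=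
    congrArg (fun y : Linf => A0 ones i + A1 y i) hG1
  have hTn : ‖A0 + A1 * G‖ < 1 := by
    refine (hT.norm_le (c := 1 - θ) fun i => ?_).trans_lt (by linarith)
    linarith [hTones i, hsum i, hθ i]
  obtain ⟨R, hR, hR_one, hR1, hR2⟩ := exists_mem_inverse (𝔄 := Linf →L[ℝ] Linf) isClosed_posCone
    ContinuousLinearMap.norm_id_le hT hTn
  have hsub : 1 - A0 - A1 * G = 1 - (A0 + A1 * G) :=
    sub_sub (1 : Linf →L[ℝ] Linf) A0 (A1 * G)
  rw [← hsub] at hR1 hR2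
  have hRc : R (Am1 ones) = ones := by
    have hc : (1 - A0 - A1 * G) ones = Am1 ones := by
      ext i
      change 1 - A0 ones i - A1 (G ones) i = Am1 ones i
      rw [hG1]
      linarith [hsum i]
    rw [← hc]
    exact DFunLike.congr_fun hR2 ones
  have hRA : ‖R * A1‖ ≤ min γ σ := by
    refine OpPos.norm_le (posCone.mul_mem hR hA1) fun i => le_min ?_ ?_
    · have h : R (A1 ones) i ≤ R (γ • Am1 ones) i := hR.mono hγle i
      rw [map_smul, hRc] at h
      exact h.trans_eq (mul_one γ)
    · have h : R (A1 ones) i ≤ R (Am1 ones - (1 - σ) • ones) i := by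
        refine hR.mono (fun j => ?_) i
        have h1 : 1 - σ ≤ Am1 ones j - A1 ones j := hgap j
        change A1 ones j ≤ Am1 ones j - (1 - σ) * 1
        linarith
      rw [map_sub, map_smul, hRc] at h
      have h1 : R (A1 ones) i ≤ 1 - (1 - σ) * R ones i := h
      have h2 : 0 ≤ R ones i - 1 := hR_one _ vnonneg_ones i
      change R (A1 ones) i ≤ σ
      nlinarith
  have hτ : min γ σ < 1 := (min_le_left _ _).trans_lt hγ
  have hRA1 : ‖R * A1‖ < 1 := hRA.trans_lt hτ
  refine ⟨R, hR1, hR2, hRA1, ?_⟩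
  have hGn : ‖G‖ ≤ 1 := hG.norm_le fun i => (DFunLike.congr_fun hG1 i).le
  exact exists_newton_seq (𝔄 := Linf →L[ℝ] Linf) isClosed_posCone (fun _ _ => OpPos.norm_mono)
    ContinuousLinearMap.norm_id_le hAm1 hA0 hA1 hG heq hGn hTn hR hR2 hτ hRA
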